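/- arXiv:math/9907106 — 2 statements merged into one kernel-verified Lean document; each statement's English description precedes it below -/
import Mathlib

section
/- Let D = (G,F,n) be a datum over an algebraically closed field k of characteristic 0 and H(D) the associated Hopf algebra. Then H(D) is pointed and G(H(D)) = G. -/
open TensorProduct

noncomputable section

universe u v w

namespace Paper

variable (k : Type*) [Field k]

section Basic

variable (A : Type*) [Ring A] [HopfAlgebra k A]

/-- `g` is a grouplike element of the Hopf algebra `A`. -/
def IsGrouplike (g : A) : Prop :=
  Coalgebra.counit (R := k) g = 1 ∧ Coalgebra.comul (R := k) g = g ⊗ₜ[k] g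

/-- `x` is a `g:h` skew primitive element of `A`, i.e. `Δ(x) = x ⊗ g + h ⊗ x`. -/
def IsSkewPrimitive (g h x : A) : Prop :=
  Coalgebra.comul (R := k) x = x ⊗ₜ[k] g + h ⊗ₜ[k] x

/-- The space `P_{g,h}(A)` of `g:h` skew primitives, as a submodule. -/
def skewPrimitives (g h : A) : Submodule k A :=
  LinearMap.ker (Coalgebra.comul (R := k) -
    ((TensorProduct.mk k A A).flip g + TensorProduct.mk k A A h))

end Basic

section Coalg

variable {M : Type*} [AddCommGroup M] [Module k M]

/-- `C` is a subcoalgebra with respect to the comultiplication `d`. -/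
def IsSubcoalgebraOf (d : M →ₗ[k] M ⊗[k] M) (C : Submodule k M) : Prop :=
  ∀ x ∈ C, d x ∈ LinearMap.range (TensorProduct.map C.subtype C.subtype)

/-- `C` is a simple subcoalgebra with respect to `d`. -/
def IsSimpleSubcoalgebraOf (d : M →ₗ[k] M ⊗[k] M) (C : Submodule k M) : Prop :=
  C ≠ ⊥ ∧ IsSubcoalgebraOf k d C ∧
    ∀ D : Submodule k M, IsSubcoalgebraOf k d D → D ≤ C → D = ⊥ ∨ D = C

/-- A coalgebra is pointed if all its simple subcoalgebras are `1`-dimensional. -/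
def IsPointedOf (d : M →ₗ[k] M ⊗[k] M) : Prop :=
  ∀ C : Submodule k M, IsSimpleSubcoalgebraOf k d C → Module.finrank k C = 1

/-- The coradical: the sum of all simple subcoalgebras. -/
def coradicalOf (d : M →ₗ[k] M ⊗[k] M) : Submodule k M :=
  sSup {C | IsSimpleSubcoalgebraOf k d C}

/-- The first term `A₁ = Δ⁻¹(A₀ ⊗ A + A ⊗ A₀)` of the coradical filtration. -/
def firstCoradicalTermOf (d : M →ₗ[k] M ⊗[k] M) : Submodule k M :=
  Submodule.comap d
    (LinearMap.range (TensorProduct.map (coradicalOf k d).subtype (LinearMap.id (M := M))) ⊔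
      LinearMap.range (TensorProduct.map (LinearMap.id (M := M)) (coradicalOf k d).subtype))

end Coalg

section Hopf

variable (A : Type*) [Ring A] [HopfAlgebra k A]

/-- A Hopf algebra is pointed if all its simple subcoalgebras are `1`-dimensional. -/
def IsPointed : Prop := IsPointedOf k (Coalgebra.comul (R := k) (A := A))

/-- A subalgebra `B` of `A` is a sub-Hopf-algebra if it is closed under
comultiplication and under the antipode. -/
def IsSubHopf (B : Subalgebra k A) : Prop :=
  (∀ x ∈ B, Coalgebra.comul (R := k) x ∈
      LinearMap.range (TensorProduct.map B.toSubmodule.subtype B.toSubmodule.subtype)) ∧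
  ∀ x ∈ B, HopfAlgebra.antipode (R := k) x ∈ B

/-- `r` belongs to `K ⊗ K ⊆ A ⊗ A` for a submodule `K` of `A`. -/
def MemTensorSquare (K : Submodule k A) (r : A ⊗[k] A) : Prop :=
  r ∈ LinearMap.range (TensorProduct.map K.subtype K.subtype)

/-- `(Δ ⊗ id)(r) = r₁₃ r₂₃`. -/
def Hexagon₁ (r : A ⊗[k] A) : Prop :=
  Algebra.TensorProduct.map (Bialgebra.comulAlgHom k A) (AlgHom.id k A) r =
    Algebra.TensorProduct.map (Algebra.TensorProduct.includeLeft (R := k) (S := k)) (AlgHom.id k A) r *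
      Algebra.TensorProduct.map (Algebra.TensorProduct.includeRight (R := k)) (AlgHom.id k A) r

/-- `(id ⊗ Δ)(r) = r₁₃ r₁₂`. -/
def Hexagon₂ (r : A ⊗[k] A) : Prop :=
  Algebra.TensorProduct.map (AlgHom.id k A) (Bialgebra.comulAlgHom k A) r =
    Algebra.TensorProduct.map (AlgHom.id k A) (Algebra.TensorProduct.includeRight (R := k)) r *
      Algebra.TensorProduct.map (AlgHom.id k A) (Algebra.TensorProduct.includeLeft (R := k) (S := k)) r

/-- The Drinfeld element `u = Σ S(R⁽²⁾) R⁽¹⁾` associated to an element `r ∈ A ⊗ A`. -/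
def drinfeldOf (r : A ⊗[k] A) : A :=
  LinearMap.mul' k A
    ((TensorProduct.map (HopfAlgebra.antipode (R := k)) LinearMap.id)
      ((TensorProduct.comm k A A) r))

/-- A quasitriangular structure on the Hopf algebra `A`. -/
structure QuasiTriangular where
  /-- the R-matrix -/
  R : A ⊗[k] A
  isUnit : IsUnit R
  intertwine : ∀ a : A,
    (TensorProduct.comm k A A) (Coalgebra.comul (R := k) a) * R = R * Coalgebra.comul (R := k) a
  hexagon₁ : Hexagon₁ k A R
  hexagon₂ : Hexagon₂ k A R

variable {A}

/-- A quasitriangular Hopf algebra is triangular if `R R₂₁ = 1 ⊗ 1`. -/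
def QuasiTriangular.IsTriangular (Q : QuasiTriangular k A) : Prop :=
  Q.R * (TensorProduct.comm k A A) Q.R = 1

/-- `(A,R)` is minimal if no proper sub-Hopf-algebra contains the components of `R`. -/
def QuasiTriangular.IsMinimal (Q : QuasiTriangular k A) : Prop :=
  ∀ B : Subalgebra k A, IsSubHopf k A B → MemTensorSquare k A B.toSubmodule Q.R → B = ⊤

/-- The Drinfeld element of a quasitriangular Hopf algebra. -/
def QuasiTriangular.drinfeld (Q : QuasiTriangular k A) : A := drinfeldOf k A Q.R

/-- The map `f_R : A* → A`, `p ↦ (p ⊗ I)(R)`. -/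
def fR (Q : QuasiTriangular k A) : Module.Dual k A →ₗ[k] A :=
  TensorProduct.lift
    (LinearMap.mk₂ k (fun a b => (Module.Dual.eval k A a).smulRight b)
      (fun a a' b => by ext p; simp [add_smul])
      (fun c a b => by ext p; simp [smul_smul])
      (fun a b b' => by ext p; simp [smul_add])
      (fun c a b => by ext p; simp [smul_comm (p a) c b])) Q.R

/-- Radford's coinvariants `B = {x ∈ A | (I ⊗ π)Δ(x) = x ⊗ 1}` of a projection `π`. -/
def coinvariants (π : A →ₗ[k] A) : Submodule k A :=
  LinearMap.ker
    ((TensorProduct.map LinearMap.id π) ∘ₗ Coalgebra.comul (R := k) -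
      (TensorProduct.mk k A A).flip 1)

end Hopf


/-- `F` is a non-degenerate skew-symmetric bilinear form on the abelian group `G`,
with values in `kˣ`: it is multiplicative in each variable, normalized, skew-symmetric,
and the associated map `g ↦ F(g,·)` is an isomorphism onto the character group of `G`. -/
structure IsNondegSkewForm (G : Type w) [CommGroup G] (F : G → G → kˣ) : Prop where
  mul_left : ∀ x y z : G, F (x * y) z = F x z * F y z
  mul_right : ∀ x y z : G, F x (y * z) = F x y * F x z
  one_left : ∀ x : G, F 1 x = 1
  one_right : ∀ x : G, F x 1 = 1
  skew : ∀ x y : G, F x y = (F y x)⁻¹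
  nondeg : ∀ χ : G →* kˣ, ∃! g : G, ∀ h : G, F g h = χ h

section Datum

variable (G : Type w) [CommGroup G] (F : G → G → kˣ) (n : G → ℕ)
  (H : Type v) [Ring H] [HopfAlgebra k H]

/-- A realization of the Hopf algebra `H(D)` associated to the datum `D = (G,F,n)`:
`H` is generated as an algebra by the grouplike elements `ι(a)`, `a ∈ G`, and the `1:g`
skew primitive elements `ψ_g(v)`, `v ∈ V_g` (where `V_g` has dimension `n g` and is
present only for `g ∈ I_F`, i.e. `F g g = -1`), subject exactly to the relations of the
group `G` and the relations `xy = F(h,g) yx`, `xa = F(a,g) ax` of the paper; the field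
`free` states the universal property of this presentation, which characterizes `H(D)`
uniquely up to isomorphism. -/
structure HDPresentation where
  ι : G →* H
  ψ : ∀ g : G, (Fin (n g) → k) →ₗ[k] H
  ι_grouplike : ∀ a : G, IsGrouplike k H (ι a)
  ψ_skewPrimitive : ∀ (g : G) (v : Fin (n g) → k), IsSkewPrimitive k H 1 (ι g) (ψ g v)
  ψ_eq_zero : ∀ g : G, F g g ≠ -1 → ψ g = 0
  comm_ψψ : ∀ g h : G, F g g = -1 → F h h = -1 →
    ∀ (v : Fin (n g) → k) (w : Fin (n h) → k),
      ψ g v * ψ h w = (F h g : k) • (ψ h w * ψ g v)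
  comm_ψι : ∀ g a : G, F g g = -1 → ∀ v : Fin (n g) → k,
    ψ g v * ι a = (F a g : k) • ((ι a : H) * ψ g v)
  generates : Algebra.adjoin k (Set.range ⇑ι ∪ ⋃ g : G, Set.range ⇑(ψ g)) = ⊤
  free : ∀ (C : Type v) [Ring C] [Algebra k C] (j : G →* C)
      (ζ : ∀ g : G, (Fin (n g) → k) →ₗ[k] C),
      (∀ g : G, F g g ≠ -1 → ζ g = 0) →
      (∀ g h : G, F g g = -1 → F h h = -1 →
        ∀ (v : Fin (n g) → k) (w : Fin (n h) → k),
          ζ g v * ζ h w = (F h g : k) • (ζ h w * ζ g v)) →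
      (∀ g a : G, F g g = -1 → ∀ v : Fin (n g) → k,
        ζ g v * j a = (F a g : k) • (j a * ζ g v)) →
      ∃! θ : H →ₐ[k] C, (∀ a : G, θ (ι a) = j a) ∧
        ∀ (g : G) (v : Fin (n g) → k), θ (ψ g v) = ζ g v

end Datum

namespace HDPresentation

variable {k : Type u} [Field k] {G : Type w} [CommGroup G] {F : G → G → kˣ} {n : G → ℕ}
  {H : Type v} [Ring H] [HopfAlgebra k H]

/-- The group `G` embeds in `H(D)`: every character `F(g,·)` extends to `H(D)` by zero on the skew
primitive generators, and these characters separate the points of `G`. -/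
theorem ι_injective (hF : IsNondegSkewForm k G F) (D : HDPresentation k G F n H) :
    Function.Injective D.ι := by
  intro a b hab
  have key : ∀ g : G, F g a = F g b := by
    intro g
    let χ : G →* k :=
      { toFun := fun x => F g x
        map_one' := by simp [hF.one_right]
        map_mul' := fun x y => by simp [hF.mul_right] }
    let j : G →* (⊥ : Subalgebra k H) := (algebraMap k (⊥ : Subalgebra k H)).toMonoidHom.comp χ
    obtain ⟨θ, ⟨hθ, -⟩, -⟩ := D.free (⊥ : Subalgebra k H) j (fun _ => 0) (fun _ _ => rfl)
      (fun _ _ _ _ _ _ => by simp) (fun _ _ _ _ => by simp)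
    have h : algebraMap k (⊥ : Subalgebra k H) (F g a) =
        algebraMap k (⊥ : Subalgebra k H) (F g b) :=
      (hθ a).symm.trans ((congrArg θ hab).trans (hθ b))
    have h' := congrArg (fun z : (⊥ : Subalgebra k H) => Coalgebra.counit (R := k) (z : H)) h
    simpa [Units.ext_iff] using h'
  obtain ⟨e, -, he⟩ := hF.nondeg 1
  have h1 : (1 : G) = e := he 1 fun h => by simp [hF.one_left]
  have h2 : a * b⁻¹ = e := he _ fun h => by
    have hb : F b h * F b⁻¹ h = 1 := by rw [← hF.mul_left, mul_inv_cancel, hF.one_left]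
    rw [hF.mul_left, hF.skew a h, key h, ← hF.skew b h, hb, MonoidHom.one_apply]
  exact mul_inv_eq_one.mp (h2.trans h1.symm)

/-- `D.IsWord m x` says that `x` is a product of generators, at most `m` of which are skew
primitive generators. -/
inductive IsWord (D : HDPresentation k G F n H) : ℕ → H → Prop
  | one : IsWord D 0 1
  | succ {m : ℕ} {x : H} : IsWord D m x → IsWord D (m + 1) x
  | ι_mul {m : ℕ} {x : H} (a : G) : IsWord D m x → IsWord D m (D.ι a * x)
  | ψ_mul {m : ℕ} {x : H} (g : G) (v : Fin (n g) → k) :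
      IsWord D m x → IsWord D (m + 1) (D.ψ g v * x)

/-- The span of the words with at most `m` skew primitive letters. -/
def filtration (D : HDPresentation k G F n H) (m : ℕ) : Submodule k H :=
  Submodule.span k {x | D.IsWord m x}

/-- The filtration shifted by one, starting with `⊥`. -/
def shiftedFiltration (D : HDPresentation k G F n H) : ℕ → Submodule k H
  | 0 => ⊥
  | m + 1 => D.filtration m

/-- The subspace `F_{m-1} ⊗ H + F_m ⊗ F_0` of `H ⊗ H`. -/
def tensorFiltration (D : HDPresentation k G F n H) (m : ℕ) : Submodule k (H ⊗[k] H) :=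
  Submodule.span k {t | ∃ u w : H, (u ∈ D.shiftedFiltration m ∨
    (u ∈ D.filtration m ∧ w ∈ D.filtration 0)) ∧ t = u ⊗ₜ[k] w}

variable (D : HDPresentation k G F n H)

theorem filtration_mono : Monotone D.filtration :=
  monotone_nat_of_le_succ fun _ => Submodule.span_mono fun _ hx => hx.succ

theorem shiftedFiltration_le_succ (m : ℕ) :
    D.shiftedFiltration m ≤ D.shiftedFiltration (m + 1) := by
  cases m with
  | zero => exact bot_le
  | succ m => exact D.filtration_mono m.le_succ

theorem shiftedFiltration_le (m : ℕ) : D.shiftedFiltration m ≤ D.filtration m :=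
  D.shiftedFiltration_le_succ m

theorem ι_mul_mem (a : G) {m : ℕ} {x : H} (hx : x ∈ D.filtration m) :
    D.ι a * x ∈ D.filtration m := by
  have : D.filtration m ≤ (D.filtration m).comap (LinearMap.mulLeft k (D.ι a)) :=
    Submodule.span_le.mpr fun y hy => Submodule.subset_span (IsWord.ι_mul a hy)
  exact this hx

theorem ψ_mul_mem (g : G) (v : Fin (n g) → k) {m : ℕ} {x : H} (hx : x ∈ D.filtration m) :
    D.ψ g v * x ∈ D.filtration (m + 1) := by
  have : D.filtration m ≤ (D.filtration (m + 1)).comap (LinearMap.mulLeft k (D.ψ g v)) :=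
    Submodule.span_le.mpr fun y hy => Submodule.subset_span (IsWord.ψ_mul g v hy)
  exact this hx

theorem ι_mul_mem_shifted (a : G) {m : ℕ} {x : H} (hx : x ∈ D.shiftedFiltration m) :
    D.ι a * x ∈ D.shiftedFiltration m := by
  cases m with
  | zero => obtain rfl : x = 0 := hx; simp
  | succ m => exact D.ι_mul_mem a hx

theorem ψ_mul_mem_shifted (g : G) (v : Fin (n g) → k) {m : ℕ} {x : H}
    (hx : x ∈ D.shiftedFiltration m) : D.ψ g v * x ∈ D.filtration m := by
  cases m with
  | zero => obtain rfl : x = 0 := hx; simp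
  | succ m => exact D.ψ_mul_mem g v hx

theorem comul_mem_of_isWord {m : ℕ} {x : H} (hx : D.IsWord m x) :
    Coalgebra.comul (R := k) x ∈ D.tensorFiltration m := by
  have h1 : (1 : H) ∈ D.filtration 0 := Submodule.subset_span IsWord.one
  induction hx with
  | one =>
    rw [Bialgebra.comul_one]
    exact Submodule.subset_span ⟨1, 1, Or.inr ⟨h1, h1⟩, rfl⟩
  | succ _ ih =>
    refine Submodule.span_mono ?_ ih
    rintro t ⟨u, w, h | h, rfl⟩
    · exact ⟨u, w, Or.inl (D.shiftedFiltration_le_succ _ h), rfl⟩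
    · exact ⟨u, w, Or.inl h.1, rfl⟩
  | @ι_mul m x a _ ih =>
    rw [Bialgebra.comul_mul, (D.ι_grouplike a).2]
    have : D.tensorFiltration m ≤ (D.tensorFiltration m).comap
        (LinearMap.mulLeft k (D.ι a ⊗ₜ[k] D.ι a)) := by
      refine Submodule.span_le.mpr ?_
      rintro t ⟨u, w, h, rfl⟩
      refine Submodule.subset_span ⟨D.ι a * u, D.ι a * w, ?_, by simp⟩
      exact h.imp (D.ι_mul_mem_shifted a) fun h => ⟨D.ι_mul_mem a h.1, D.ι_mul_mem a h.2⟩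
    exact this ih
  | @ψ_mul m x g v _ ih =>
    rw [Bialgebra.comul_mul, D.ψ_skewPrimitive g v]
    have : D.tensorFiltration m ≤ (D.tensorFiltration (m + 1)).comap
        (LinearMap.mulLeft k (D.ψ g v ⊗ₜ[k] 1 + D.ι g ⊗ₜ[k] D.ψ g v)) := by
      refine Submodule.span_le.mpr ?_
      rintro t ⟨u, w, h, rfl⟩
      have hu : u ∈ D.filtration m := h.elim (fun h => D.shiftedFiltration_le m h) And.left
      have e : LinearMap.mulLeft k (D.ψ g v ⊗ₜ[k] 1 + D.ι g ⊗ₜ[k] D.ψ g v) (u ⊗ₜ[k] w) =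
          (D.ψ g v * u) ⊗ₜ[k] w + (D.ι g * u) ⊗ₜ[k] (D.ψ g v * w) := by
        simp [add_mul]
      change LinearMap.mulLeft k _ (u ⊗ₜ[k] w) ∈ D.tensorFiltration (m + 1)
      rw [e]
      refine add_mem (Submodule.subset_span ⟨_, _, ?_, rfl⟩)
        (Submodule.subset_span ⟨_, _, Or.inl (D.ι_mul_mem g hu), rfl⟩)
      exact h.imp (D.ψ_mul_mem_shifted g v) fun h => ⟨D.ψ_mul_mem g v h.1, h.2⟩
    exact this ih

theorem comul_mem_tensorFiltration {m : ℕ} {x : H} (hx : x ∈ D.filtration m) :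
    Coalgebra.comul (R := k) x ∈ D.tensorFiltration m := by
  have : D.filtration m ≤ (D.tensorFiltration m).comap (Coalgebra.comul (R := k)) :=
    Submodule.span_le.mpr fun _ => D.comul_mem_of_isWord
  exact this hx

theorem exists_mem_filtration (x : H) : ∃ m, x ∈ D.filtration m := by
  have hx : x ∈ Submodule.span k
      (Submonoid.closure (Set.range ⇑D.ι ∪ ⋃ g : G, Set.range ⇑(D.ψ g)) : Set H) := by
    rw [← Algebra.adjoin_eq_span, D.generates]
    exact Submodule.mem_top
  induction hx using Submodule.span_induction with
  | mem y hy =>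
    suffices ∃ m, D.IsWord m y from this.imp fun _ h => Submodule.subset_span h
    induction hy using Submonoid.closure_induction_left with
    | one => exact ⟨0, IsWord.one⟩
    | mul_left s hs y _ ih =>
      obtain ⟨m, hm⟩ := ih
      rcases hs with ⟨a, rfl⟩ | hs
      · exact ⟨m, hm.ι_mul a⟩
      · obtain ⟨g, v, rfl⟩ := Set.mem_iUnion.mp hs
        exact ⟨m + 1, hm.ψ_mul g v⟩
  | zero => exact ⟨0, zero_mem _⟩
  | add y z _ _ hy hz =>
    obtain ⟨a, ha⟩ := hy
    obtain ⟨b, hb⟩ := hz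
    exact ⟨max a b, add_mem (D.filtration_mono (le_max_left a b) ha)
      (D.filtration_mono (le_max_right a b) hb)⟩
  | smul c y _ hy => exact hy.imp fun _ h => Submodule.smul_mem _ c h

theorem filtration_zero_le : D.filtration 0 ≤ Submodule.span k (Set.range ⇑D.ι) := by
  refine Submodule.span_mono fun x hx => ?_
  have key : ∀ (m : ℕ) (y : H), D.IsWord m y → m = 0 → y ∈ Set.range ⇑D.ι := by
    intro m y hy
    induction hy with
    | one => exact fun _ => ⟨1, map_one _⟩
    | succ => intro h; omega
    | ι_mul a _ ih =>
      intro h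
      obtain ⟨b, rfl⟩ := ih h
      exact ⟨a * b, map_mul _ _ _⟩
    | ψ_mul => intro h; omega
  exact key 0 x hx rfl

end HDPresentation

section Contraction

variable {k : Type u} [Field k] {H : Type v} [Ring H] [HopfAlgebra k H]

/-- The contraction `u ⊗ w ↦ f(w) u` of the second tensor factor. -/
def contractRight (f : H →ₗ[k] k) : H ⊗[k] H →ₗ[k] H :=
  (TensorProduct.rid k H).toLinearMap ∘ₗ LinearMap.lTensor H f

@[simp]
theorem contractRight_tmul (f : H →ₗ[k] k) (u w : H) :
    contractRight f (u ⊗ₜ[k] w) = f w • u := by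
  simp [contractRight]

theorem IsSubcoalgebraOf.contractRight_comul_mem {C : Submodule k H}
    (hC : IsSubcoalgebraOf k (Coalgebra.comul (R := k) (A := H)) C) (f : H →ₗ[k] k)
    {x : H} (hx : x ∈ C) : contractRight f (Coalgebra.comul (R := k) x) ∈ C := by
  obtain ⟨t, ht⟩ := hC x hx
  rw [← ht]
  clear ht
  induction t with
  | zero => simp
  | tmul u w => simpa using C.smul_mem _ u.2
  | add s t hs ht => simpa only [map_add] using add_mem hs ht

theorem counit_contractRight_comul (f : H →ₗ[k] k) (x : H) :
    Coalgebra.counit (R := k) (contractRight f (Coalgebra.comul (R := k) x)) = f x := by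
  have h : ∀ t : H ⊗[k] H, Coalgebra.counit (R := k) (contractRight f t) =
      f (TensorProduct.lid k H (LinearMap.rTensor H (Coalgebra.counit (R := k)) t)) := by
    intro t
    induction t with
    | zero => simp
    | tmul u w => simp [mul_comm]
    | add s t hs ht => simp only [map_add, hs, ht]
  rw [h, Coalgebra.rTensor_counit_comul]
  simp

end Contraction

namespace HDPresentation

variable {k : Type u} [Field k] {G : Type w} [CommGroup G] {F : G → G → kˣ} {n : G → ℕ}
  {H : Type v} [Ring H] [HopfAlgebra k H] (D : HDPresentation k G F n H)

theorem contractRight_comul_mem_shifted {f : H →ₗ[k] k} (hf : ∀ y ∈ D.filtration 0, f y = 0)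
    {m : ℕ} {x : H} (hx : x ∈ D.filtration m) :
    contractRight f (Coalgebra.comul (R := k) x) ∈ D.shiftedFiltration m := by
  have : D.tensorFiltration m ≤ (D.shiftedFiltration m).comap (contractRight f) := by
    refine Submodule.span_le.mpr ?_
    rintro t ⟨u, w, h | h, rfl⟩
    · simpa using Submodule.smul_mem _ _ h
    · simp [hf w h.2]
  exact this (D.comul_mem_tensorFiltration hx)

theorem exists_mem_filtration_zero {C : Submodule k H}
    (hC : IsSubcoalgebraOf k (Coalgebra.comul (R := k) (A := H)) C) (hC0 : C ≠ ⊥) :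
    ∃ x ∈ C, x ≠ 0 ∧ x ∈ D.filtration 0 := by
  have key : ∀ (m : ℕ) (x : H), x ∈ C → x ≠ 0 → x ∈ D.filtration m →
      ∃ x ∈ C, x ≠ 0 ∧ x ∈ D.filtration 0 := by
    intro m
    induction m with
    | zero => exact fun x hx hx0 hxm => ⟨x, hx, hx0, hxm⟩
    | succ m ih =>
      intro x hx hx0 hxm
      by_cases hx1 : x ∈ D.filtration 0
      · exact ⟨x, hx, hx0, hx1⟩
      obtain ⟨f, hfx, hf⟩ := Submodule.exists_le_ker_of_notMem hx1
      refine ih _ (hC.contractRight_comul_mem f hx) (fun h => hfx ?_)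
        (D.contractRight_comul_mem_shifted (fun y hy => hf hy) hxm)
      rw [← counit_contractRight_comul f x, h, map_zero]
  obtain ⟨x, hx, hx0⟩ := C.ne_bot_iff.mp hC0
  obtain ⟨m, hm⟩ := D.exists_mem_filtration x
  exact key m x hx hx0 hm

theorem linearIndependent_ι (hι : Function.Injective D.ι) : LinearIndependent k ⇑D.ι := by
  have h := linearIndepOn_isGroupLikeElem (R := k) (A := H)
  exact h.comp (fun a => ⟨D.ι a, ⟨(D.ι_grouplike a).1, (D.ι_grouplike a).2⟩⟩)
    fun a b hab => hι (congrArg Subtype.val hab)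

/-- Every nonzero subcoalgebra of `H(D)` contains one of the grouplike generators. -/
theorem exists_ι_mem (hι : Function.Injective D.ι) {C : Submodule k H}
    (hC : IsSubcoalgebraOf k (Coalgebra.comul (R := k) (A := H)) C) (hC0 : C ≠ ⊥) :
    ∃ a, D.ι a ∈ C := by
  classical
  obtain ⟨x, hx, hx0, hxF⟩ := D.exists_mem_filtration_zero hC hC0
  obtain ⟨c, rfl⟩ := Finsupp.mem_span_range_iff_exists_finsupp.mp (D.filtration_zero_le hxF)
  obtain ⟨a, ha⟩ : ∃ a, c a ≠ 0 := by
    by_contra! h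
    exact hx0 (by simp [Finsupp.sum, h])
  have hl := D.linearIndependent_ι hι
  obtain ⟨p, hp⟩ := LinearMap.exists_extend (Finsupp.lapply a ∘ₗ hl.repr)
  have hpι : ∀ b, p (D.ι b) = if b = a then (1 : k) else 0 := by
    intro b
    have h := LinearMap.congr_fun hp ⟨D.ι b, Submodule.subset_span ⟨b, rfl⟩⟩
    rw [LinearMap.comp_apply, LinearMap.comp_apply,
      hl.repr_eq_single b _ rfl] at h
    simpa [Finsupp.single_apply] using h
  refine ⟨a, (C.smul_mem_iff ha).mp ?_⟩
  have h := hC.contractRight_comul_mem p hx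
  simpa [Finsupp.sum, map_sum, (D.ι_grouplike _).2, hpι, ha] using h

end HDPresentation

theorem IsGrouplike.ne_zero {k : Type u} [Field k] {H : Type v} [Ring H] [HopfAlgebra k H]
    {x : H} (hx : IsGrouplike k H x) : x ≠ 0 := by
  rintro rfl
  simpa using hx.1

theorem IsGrouplike.isSubcoalgebraOf_span {k : Type u} [Field k] {H : Type v} [Ring H]
    [HopfAlgebra k H] {x : H} (hx : IsGrouplike k H x) :
    IsSubcoalgebraOf k (Coalgebra.comul (R := k) (A := H)) (Submodule.span k {x}) := by
  intro y hy
  obtain ⟨c, rfl⟩ := Submodule.mem_span_singleton.mp hy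
  rw [map_smul, hx.2]
  exact Submodule.smul_mem _ c ⟨⟨x, Submodule.mem_span_singleton_self x⟩ ⊗ₜ[k]
    ⟨x, Submodule.mem_span_singleton_self x⟩, rfl⟩

/-- Let `D = (G,F,n)` be a datum over an algebraically closed field `k`
of characteristic `0` and `H(D)` the associated Hopf algebra. Then `H(D)` is pointed
and `G(H(D)) = G`. -/
theorem HD_pointed_and_grouplikes
    (k : Type u) [Field k] [IsAlgClosed k] [CharZero k]
    (G : Type w) [CommGroup G] [Fintype G] (F : G → G → kˣ) (n : G → ℕ)
    (hF : IsNondegSkewForm k G F)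
    (H : Type v) [Ring H] [HopfAlgebra k H] (D : HDPresentation k G F n H) :
    IsPointed k H ∧ Function.Injective D.ι ∧
      {x : H | IsGrouplike k H x} = Set.range ⇑D.ι := by
  have hι := D.ι_injective hF
  have hspan : ∀ x : H, IsGrouplike k H x → Submodule.span k {x} ≠ ⊥ := fun x hx => by
    simpa using hx.ne_zero
  refine ⟨fun C hC => ?_, hι, Set.Subset.antisymm (fun x hx => ?_) ?_⟩
  · obtain ⟨hC0, hsub, hmin⟩ := hC
    obtain ⟨a, ha⟩ := D.exists_ι_mem hι hsub hC0
    have hg := D.ι_grouplike a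
    rw [← (hmin _ hg.isSubcoalgebraOf_span
      ((Submodule.span_singleton_le_iff_mem _ _).mpr ha)).resolve_left (hspan _ hg)]
    exact finrank_span_singleton hg.ne_zero
  · obtain ⟨a, ha⟩ := D.exists_ι_mem hι (IsGrouplike.isSubcoalgebraOf_span hx) (hspan x hx)
    obtain ⟨c, hc⟩ := Submodule.mem_span_singleton.mp ha
    have h := (D.ι_grouplike a).1
    rw [← hc, map_smul, hx.1, smul_eq_mul, mul_one] at h
    exact ⟨a, by rw [← hc, h, one_smul]⟩
  · rintro _ ⟨a, rfl⟩
    exact D.ι_grouplike a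

end Paper
end
end

section
/- Let D = (G,F,n) be a datum over an algebraically closed field k of characteristic 0 and H(D) the associated Hopf algebra. Then the map π: H(D) → k[G] determined by π(a) = a for a ∈ G and π(x) = 0 for x ∈ 𝓑 is a projection of Hopf algebras, and H(D) = B × k[G] is a biproduct, where B := ⊗_{g∈I_F} ΛV_g is the tensor product of the exterior algebras of the spaces V_g. -/
open TensorProduct

noncomputable section

universe u v w

namespace Paper

variable (k : Type*) [Field k]

section Adjoin

variable {k : Type*} [Field k] {A : Type*} [Ring A] [Algebra k A]

lemma toSubmodule_adjoin_le {s : Set A} {M : Submodule k A} (one_mem : 1 ∈ M)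
    (mul_mem : ∀ x ∈ s, ∀ y ∈ M, x * y ∈ M) : Subalgebra.toSubmodule (Algebra.adjoin k s) ≤ M := by
  rw [Algebra.adjoin_eq_span, Submodule.span_le]
  intro y hy
  induction hy using Submonoid.closure_induction_left with
  | one => exact one_mem
  | mul_left x hx y _ ih => exact mul_mem x hx y ih

end Adjoin

section SkewCommuting

variable {k : Type*} [Field k] {A : Type*} [Ring A] [Algebra k A] {X : Type*}

/-- The product of the family `x` over the finite set `S`, in an arbitrary fixed order. -/
def listProd (x : X → A) (S : Finset X) : A := (S.toList.map x).prod

variable {x : X → A} {q : X → X → k}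

lemma exists_smul_prod_of_perm (hq : ∀ i j, x i * x j = q i j • (x j * x i)) {l l' : List X}
    (h : l.Perm l') : ∃ c : k, (l.map x).prod = c • (l'.map x).prod := by
  induction h with
  | nil => exact ⟨1, by simp⟩
  | cons i _ ih =>
    obtain ⟨c, hc⟩ := ih
    exact ⟨c, by simp [hc]⟩
  | swap i j l =>
    refine ⟨q j i, ?_⟩
    simp only [List.map_cons, List.prod_cons]
    rw [← mul_assoc, hq j i, smul_mul_assoc, mul_assoc]
  | trans _ _ ih₁ ih₂ =>
    obtain ⟨c, hc⟩ := ih₁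
    obtain ⟨d, hd⟩ := ih₂
    exact ⟨c * d, by rw [hc, hd, smul_smul]⟩

lemma mul_listProd_mem [DecidableEq X] (hq : ∀ i j, x i * x j = q i j • (x j * x i))
    (hsq : ∀ i, x i * x i = 0) (i : X) (S : Finset X) :
    x i * listProd x S ∈ Submodule.span k (Set.range (listProd x)) := by
  by_cases hi : i ∈ S
  · have hp : S.toList.Perm (i :: (S.erase i).toList) := by
      conv_lhs => rw [← Finset.insert_erase hi]
      exact Finset.toList_insert (Finset.notMem_erase i S)
    obtain ⟨c, hc⟩ := exists_smul_prod_of_perm hq hp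
    rw [listProd, hc, List.map_cons, List.prod_cons, mul_smul_comm, ← mul_assoc, hsq]
    simp
  · obtain ⟨c, hc⟩ := exists_smul_prod_of_perm hq (Finset.toList_insert hi).symm
    rw [List.map_cons, List.prod_cons] at hc
    rw [listProd, hc]
    exact Submodule.smul_mem _ _ (Submodule.subset_span ⟨_, rfl⟩)

lemma toSubmodule_adjoin_range_eq_span_listProd
    (hq : ∀ i j, x i * x j = q i j • (x j * x i)) (hsq : ∀ i, x i * x i = 0) :
    Subalgebra.toSubmodule (Algebra.adjoin k (Set.range x)) =
      Submodule.span k (Set.range (listProd x)) := by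
  classical
  apply le_antisymm
  · refine toSubmodule_adjoin_le (Submodule.subset_span ⟨∅, by simp [listProd]⟩) ?_
    rintro _ ⟨i, rfl⟩ y hy
    induction hy using Submodule.span_induction with
    | mem y hy =>
      obtain ⟨S, rfl⟩ := hy
      exact mul_listProd_mem hq hsq i S
    | zero => simp
    | add y z _ _ hy hz => rw [mul_add]; exact add_mem hy hz
    | smul c y _ hy => rw [mul_smul_comm]; exact Submodule.smul_mem _ _ hy
  · rw [Submodule.span_le]
    rintro _ ⟨S, rfl⟩
    refine Subalgebra.list_prod_mem _ fun y hy => ?_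
    obtain ⟨i, _, rfl⟩ := List.mem_map.1 hy
    exact Algebra.subset_adjoin ⟨i, rfl⟩

end SkewCommuting

section Fock

variable {k : Type*} [Field k] {M : Type*} [AddCommGroup M] [Module k M]
  {X : Type*}

/-- The diagonal operator on `M`-valued functions on finite subsets of `X` attached to a
multiplicative weight. -/
def diagonalOperator (M : Type*) [AddCommGroup M] [Module k M] {G : Type*} [CommGroup G]
    (χ : X → G →* kˣ) : G →* Module.End k (Finset X → M) where
  toFun a :=
    { toFun := fun f S => ((∏ j ∈ S, χ j a : kˣ) : k) • f S
      map_add' := fun f g => by ext S; simp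
      map_smul' := fun c f => by ext S; simp [smul_comm c] }
  map_one' := by ext f S; simp
  map_mul' a b := by ext f S; simp [Finset.prod_mul_distrib, smul_smul]

lemma diagonalOperator_apply {G : Type*} [CommGroup G] (χ : X → G →* kˣ) (a : G)
    (f : Finset X → M) (S : Finset X) :
    diagonalOperator M χ a f S = ((∏ j ∈ S, χ j a : kˣ) : k) • f S := rfl

variable [DecidableEq X]

/-- The creation operator at `i` on `M`-valued functions on finite subsets of `X`, twisted by
the coefficients `r i j`. -/
def creation (M : Type*) [AddCommGroup M] [Module k M] (r : X → X → k) (i : X) :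
    Module.End k (Finset X → M) where
  toFun f S := if i ∈ S then (∏ j ∈ S.erase i, r i j) • f (S.erase i) else 0
  map_add' f g := by ext S; by_cases h : i ∈ S <;> simp [h]
  map_smul' c f := by ext S; by_cases h : i ∈ S <;> simp [h, smul_comm c]

lemma creation_apply (r : X → X → k) (i : X) (f : Finset X → M) (S : Finset X) :
    creation M r i f S = if i ∈ S then (∏ j ∈ S.erase i, r i j) • f (S.erase i) else 0 := rfl

lemma creation_mul_self (r : X → X → k) (i : X) : creation M r i * creation M r i = 0 := by
  ext f S
  simp [creation_apply]

lemma creation_mul_creation {r : X → X → k} {i j : X} {c : k}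
    (h : i ≠ j → r i j = c * r j i) :
    creation M r i * creation M r j = c • (creation M r j * creation M r i) := by
  obtain rfl | hij := eq_or_ne i j
  · simp [creation_mul_self]
  ext f S
  simp only [Module.End.mul_apply, LinearMap.smul_apply, Pi.smul_apply, creation_apply,
    Finset.mem_erase]
  by_cases hi : i ∈ S <;> by_cases hj : j ∈ S <;> simp only [hi, hj, hij, hij.symm, ne_eq,
    not_false_eq_true, and_self, if_true, if_false, smul_zero, and_false]
  rw [← Finset.mul_prod_erase (S.erase i) (r i) (Finset.mem_erase.2 ⟨hij.symm, hj⟩),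
    ← Finset.mul_prod_erase (S.erase j) (r j) (Finset.mem_erase.2 ⟨hij, hi⟩),
    Finset.erase_right_comm (a := j) (b := i), h hij]
  simp only [smul_smul]
  congr 1
  ring

lemma creation_mul_diagonalOperator {G : Type*} [CommGroup G] (χ : X → G →* kˣ) (a : G)
    (r : X → X → k) (i : X) :
    creation M r i * diagonalOperator M χ a =
      (((χ i a)⁻¹ : kˣ) : k) • (diagonalOperator M χ a * creation M r i) := by
  ext f S
  simp only [Module.End.mul_apply, LinearMap.smul_apply, Pi.smul_apply, creation_apply,
    diagonalOperator_apply]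
  by_cases hi : i ∈ S
  · rw [if_pos hi, if_pos hi, ← Finset.mul_prod_erase S _ hi]
    simp only [smul_smul]
    congr 1
    rw [Units.val_mul, mul_comm, ← mul_assoc, ← mul_assoc, Units.inv_mul, one_mul]
  · simp [hi]

lemma exists_prod_creation_apply_single {r : X → X → k} (hr : ∀ i j, r i j ≠ 0) (m : M)
    {l : List X} (hl : l.Nodup) :
    ∃ c : k, c ≠ 0 ∧
      (l.map (creation M r)).prod (Pi.single ∅ m) = c • Pi.single l.toFinset m := by
  induction l with
  | nil => exact ⟨1, one_ne_zero, by simp⟩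
  | cons i l ih =>
    obtain ⟨hi, hl⟩ := List.nodup_cons.1 hl
    obtain ⟨c, hc, h⟩ := ih hl
    refine ⟨(∏ j ∈ l.toFinset, r i j) * c,
      mul_ne_zero (Finset.prod_ne_zero_iff.2 fun j _ => hr i j) hc, ?_⟩
    rw [List.map_cons, List.prod_cons, Module.End.mul_apply, h]
    ext S
    rw [creation_apply, List.toFinset_cons]
    have hi' : i ∉ l.toFinset := by simpa using hi
    by_cases hS : S = insert i l.toFinset
    · subst hS
      simp [Finset.erase_insert hi', smul_smul]
    · simp only [Pi.smul_apply, Pi.single_apply, hS, if_false, smul_zero]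
      by_cases hiS : i ∈ S
      · rw [if_pos hiS, if_neg, smul_zero, smul_zero]
        intro h
        exact hS (by rw [← h, Finset.insert_erase hiS])
      · rw [if_neg hiS]

lemma linearIndependent_listProd_of_creation {A : Type*} [Ring A] [Algebra k A] [Nontrivial M]
    {r : X → X → k} (hr : ∀ i j, r i j ≠ 0) {x : X → A}
    (θ : A →ₐ[k] Module.End k (Finset X → M)) (hθ : ∀ i, θ (x i) = creation M r i) :
    LinearIndependent k (listProd x) := by
  obtain ⟨m, hm⟩ := exists_ne (0 : M)
  have key : ∀ S : Finset X, ∃ c : k, c ≠ 0 ∧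
      θ (listProd x S) (Pi.single ∅ m) = c • Pi.single S m := by
    intro S
    have h := exists_prod_creation_apply_single hr m S.nodup_toList
    rw [Finset.toList_toFinset] at h
    rw [listProd, map_list_prod, List.map_map]
    simpa only [Function.comp_def, hθ] using h
  choose c hc h using key
  rw [linearIndependent_iff']
  intro s g hg S hS
  have h0 := congrFun (congrArg (fun a => θ a (Pi.single ∅ m)) hg) S
  simp only [map_sum, map_smul, LinearMap.sum_apply, LinearMap.smul_apply, h, map_zero,
    LinearMap.zero_apply, Finset.sum_apply, Pi.smul_apply, Pi.single_apply, Pi.zero_apply,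
    smul_ite, smul_zero, Finset.sum_ite_eq, hS, if_true] at h0
  simpa [hc S, hm] using h0

end Fock

section Projection

variable {k : Type*} [Field k] {A : Type*} [Ring A] [HopfAlgebra k A]

/-- The algebra homomorphism `(I ⊗ π)Δ`. -/
def rightCoaction (π : A →ₐ[k] A) : A →ₐ[k] A ⊗[k] A :=
  (Algebra.TensorProduct.map (AlgHom.id k A) π).comp (Bialgebra.comulAlgHom k A)

lemma mem_coinvariants_iff {π : A →ₐ[k] A} {x : A} :
    x ∈ coinvariants k π.toLinearMap ↔ rightCoaction π x = x ⊗ₜ 1 := by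
  rw [coinvariants, LinearMap.mem_ker, LinearMap.sub_apply, sub_eq_zero]
  rfl

lemma adjoin_le_coinvariants {π : A →ₐ[k] A} {s : Set A}
    (hs : s ⊆ coinvariants k π.toLinearMap) :
    Subalgebra.toSubmodule (Algebra.adjoin k s) ≤ coinvariants k π.toLinearMap := by
  have h : Algebra.adjoin k s ≤
      AlgHom.equalizer (rightCoaction π) Algebra.TensorProduct.includeLeft :=
    Algebra.adjoin_le fun x hx => mem_coinvariants_iff.1 (hs hx)
  exact fun x hx => mem_coinvariants_iff.2 (h hx)

lemma IsSkewPrimitive.counit_eq_zero {g x : A} (hg : IsGrouplike k A g)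
    (hx : IsSkewPrimitive k A 1 g x) : Coalgebra.counit (R := k) x = 0 := by
  have h := Coalgebra.rTensor_counit_comul (R := k) x
  rw [IsSkewPrimitive] at hx
  rw [hx, map_add, LinearMap.rTensor_tmul, LinearMap.rTensor_tmul, hg.1, add_eq_right] at h
  simpa using congrArg (LinearMap.mul' k k ∘ₗ
    TensorProduct.map LinearMap.id (Coalgebra.counit (R := k) (A := A))) h

/-- The linear map `x ⊗ y ↦ ∑ x S(y₁) ⊗ y₂`. -/
def translationMap (k A : Type*) [Field k] [Ring A] [HopfAlgebra k A] :
    A ⊗[k] A →ₗ[k] A ⊗[k] A :=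
  (LinearMap.mul' k A).rTensor A ∘ₗ (TensorProduct.assoc k A A A).symm.toLinearMap ∘ₗ
    LinearMap.lTensor A ((HopfAlgebra.antipode k).rTensor A ∘ₗ Coalgebra.comul)

lemma translationMap_mul_tmul {a : A} (ha : IsGrouplike k A a) (b : A) :
    translationMap k A ((b * a) ⊗ₜ a) = b ⊗ₜ a := by
  have ha' : IsGroupLikeElem k a := ⟨ha.1, ha.2⟩
  simp [translationMap, ha.2, mul_assoc, ha'.mul_antipode_cancel]

variable {π : A →ₐ[k] A} {s : Set A}

lemma translationMap_rightCoaction_mul (hs : ∀ a ∈ s, IsGrouplike k A a) (hπ : ∀ a ∈ s, π a = a)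
    (t : coinvariants k π.toLinearMap ⊗[k] Submodule.span k s) :
    translationMap k A (rightCoaction π (LinearMap.mul' k A
      (TensorProduct.map (coinvariants k π.toLinearMap).subtype
        (Submodule.span k s).subtype t))) =
      TensorProduct.map (coinvariants k π.toLinearMap).subtype (Submodule.span k s).subtype t := by
  induction t with
  | zero => simp
  | add t u ht hu => simp only [map_add, ht, hu]
  | tmul b c =>
    obtain ⟨b, hb⟩ := b
    obtain ⟨c, hc⟩ := c
    simp only [TensorProduct.map_tmul, Submodule.subtype_apply, LinearMap.mul'_apply, map_mul,
      mem_coinvariants_iff.1 hb]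
    induction hc using Submodule.span_induction with
    | mem a ha =>
      have h : rightCoaction π a = a ⊗ₜ a := by
        simp [rightCoaction, (hs a ha).2, hπ a ha]
      rw [h, Algebra.TensorProduct.tmul_mul_tmul, one_mul, translationMap_mul_tmul (hs a ha)]
    | zero => simp
    | add y z _ _ hy hz => rw [map_add, mul_add, map_add, hy, hz, TensorProduct.tmul_add]
    | smul c y _ hy => rw [map_smul, mul_smul_comm, map_smul, hy, TensorProduct.tmul_smul]

lemma injective_mul_coinvariants (hs : ∀ a ∈ s, IsGrouplike k A a) (hπ : ∀ a ∈ s, π a = a) :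
    Function.Injective (LinearMap.mul' k A ∘ₗ
      TensorProduct.map (coinvariants k π.toLinearMap).subtype
        (Submodule.span k s).subtype) := by
  intro t u htu
  refine TensorProduct.map_injective_of_flat_flat _ _ (Submodule.subtype_injective _)
    (Submodule.subtype_injective _) ?_
  rw [← translationMap_rightCoaction_mul hs hπ t, ← translationMap_rightCoaction_mul hs hπ u]
  exact congrArg (fun y => translationMap k A (rightCoaction π y)) htu

/-- If a submodule `B` of the coinvariants satisfies `B * k[s] = A`, then it is all of the
coinvariants. -/
lemma coinvariants_eq_of_mul_span_eq_top (hs : ∀ a ∈ s, IsGrouplike k A a)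
    (hπ : ∀ a ∈ s, π a = a) (h1 : (1 : A) ∈ s) {B : Submodule k A}
    (hB : B ≤ coinvariants k π.toLinearMap) (htop : B * Submodule.span k s = ⊤) :
    coinvariants k π.toLinearMap = B := by
  refine le_antisymm (fun x hx => ?_) hB
  have key : ∀ y ∈ B * Submodule.span k s,
      ∃ t : coinvariants k π.toLinearMap ⊗[k] Submodule.span k s,
        LinearMap.mul' k A (TensorProduct.map (coinvariants k π.toLinearMap).subtype
          (Submodule.span k s).subtype t) = y ∧
        TensorProduct.rid k A (TensorProduct.map (coinvariants k π.toLinearMap).subtype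
          (Coalgebra.counit (R := k) ∘ₗ (Submodule.span k s).subtype) t) ∈ B := by
    intro y hy
    induction hy using Submodule.mul_induction_on' with
    | mem_mul_mem b hb c hc =>
      exact ⟨⟨b, hB hb⟩ ⊗ₜ ⟨c, hc⟩, by simp, by simpa using B.smul_mem _ hb⟩
    | add y _ z _ hy hz =>
      obtain ⟨t, rfl, ht⟩ := hy
      obtain ⟨u, rfl, hu⟩ := hz
      exact ⟨t + u, by simp, by simpa using add_mem ht hu⟩
  obtain ⟨t, ht, htB⟩ := key x (htop ▸ Submodule.mem_top)
  have : t = ⟨x, hx⟩ ⊗ₜ ⟨1, Submodule.subset_span h1⟩ :=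
    injective_mul_coinvariants hs hπ (by simpa using ht)
  rw [this] at htB
  simpa using htB

lemma surjective_mul_coinvariants {B : Submodule k A} (hB : B ≤ coinvariants k π.toLinearMap)
    (htop : B * Submodule.span k s = ⊤) :
    Function.Surjective (LinearMap.mul' k A ∘ₗ
      TensorProduct.map (coinvariants k π.toLinearMap).subtype
        (Submodule.span k s).subtype) := by
  rw [← LinearMap.range_eq_top, eq_top_iff, ← htop, Submodule.mul_le]
  intro b hb c hc
  exact ⟨⟨b, hB hb⟩ ⊗ₜ ⟨c, hc⟩, by simp⟩

end Projection

lemma IsNondegSkewForm.mul_swap {k : Type*} [Field k] {G : Type*} [CommGroup G] {F : G → G → kˣ}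
    (hF : IsNondegSkewForm k G F) (g h : G) : (F g h : k) * F h g = 1 := by
  rw [hF.skew g h, Units.inv_mul]

namespace HDPresentation

variable {k : Type u} [Field k] {G : Type w} [CommGroup G] {F : G → G → kˣ} {n : G → ℕ}
  {H : Type v} [Ring H] [HopfAlgebra k H] (D : HDPresentation k G F n H)

lemma algHom_ext {C : Type*} [Ring C] [Algebra k C] {φ χ : H →ₐ[k] C}
    (hι : ∀ a, φ (D.ι a) = χ (D.ι a)) (hψ : ∀ g v, φ (D.ψ g v) = χ (D.ψ g v)) : φ = χ := by
  refine AlgHom.ext_of_adjoin_eq_top D.generates ?_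
  rintro y (⟨a, rfl⟩ | hy)
  · exact hι a
  · obtain ⟨g, v, rfl⟩ := Set.mem_iUnion.1 hy
    exact hψ g v

lemma counit_ψ (g : G) (v : Fin (n g) → k) : Coalgebra.counit (R := k) (D.ψ g v) = 0 :=
  (D.ψ_skewPrimitive g v).counit_eq_zero (D.ι_grouplike g)

lemma exists_projection : ∃ π : H →ₐ[k] H, (∀ a, π (D.ι a) = D.ι a) ∧ ∀ g v, π (D.ψ g v) = 0 := by
  obtain ⟨π, h, -⟩ := D.free H D.ι (fun _ => 0) (by simp) (by simp) (by simp)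
  exact ⟨π, h.1, by simpa using h.2⟩

lemma toSubmodule_adjoin_range_ι :
    Subalgebra.toSubmodule (Algebra.adjoin k (Set.range D.ι)) =
      Submodule.span k (Set.range D.ι) := by
  rw [Algebra.adjoin_eq_span, ← MonoidHom.coe_mrange, Submonoid.closure_eq]

section Projection

variable {D} {π : H →ₐ[k] H}

lemma comul_projection (hι : ∀ a, π (D.ι a) = D.ι a) (hψ : ∀ g v, π (D.ψ g v) = 0)
    (x : H) : Coalgebra.comul (R := k) (π x) =
    TensorProduct.map π.toLinearMap π.toLinearMap (Coalgebra.comul (R := k) x) := by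
  have h : (Bialgebra.comulAlgHom k H).comp π =
      (Algebra.TensorProduct.map π π).comp (Bialgebra.comulAlgHom k H) := by
    refine D.algHom_ext (fun a => ?_) (fun g v => ?_)
    · simp [hι, (D.ι_grouplike a).2]
    · have := D.ψ_skewPrimitive g v
      rw [IsSkewPrimitive] at this
      simp [hψ, this]
  exact DFunLike.congr_fun h x

lemma counit_projection (hι : ∀ a, π (D.ι a) = D.ι a) (hψ : ∀ g v, π (D.ψ g v) = 0)
    (x : H) :
    Coalgebra.counit (R := k) (π x) = Coalgebra.counit (R := k) x := by
  have h : (Bialgebra.counitAlgHom k H).comp π = Bialgebra.counitAlgHom k H :=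
    D.algHom_ext (fun a => by simp [hι]) (fun g v => by simp [hψ, D.counit_ψ])
  exact DFunLike.congr_fun h x

lemma range_projection (hι : ∀ a, π (D.ι a) = D.ι a) (hψ : ∀ g v, π (D.ψ g v) = 0) :
    LinearMap.range π.toLinearMap = Submodule.span k (Set.range D.ι) := by
  apply le_antisymm
  · rw [← D.toSubmodule_adjoin_range_ι, LinearMap.range_le_iff_comap, eq_top_iff,
      ← Algebra.top_toSubmodule, ← D.generates]
    refine (Algebra.adjoin_le (S := (Algebra.adjoin k (Set.range D.ι)).comap π) ?_ :)
    rintro y (⟨a, rfl⟩ | hy)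
    · exact Algebra.subset_adjoin ⟨a, (hι a).symm⟩
    · obtain ⟨g, v, rfl⟩ := Set.mem_iUnion.1 hy
      simp [hψ]
  · rw [Submodule.span_le]
    rintro _ ⟨a, rfl⟩
    exact ⟨D.ι a, hι a⟩

lemma ψ_mem_coinvariants (hψ : ∀ g v, π (D.ψ g v) = 0) (g : G) (v : Fin (n g) → k) :
    D.ψ g v ∈ coinvariants k π.toLinearMap := by
  have := D.ψ_skewPrimitive g v
  rw [IsSkewPrimitive] at this
  simp [mem_coinvariants_iff, rightCoaction, this, hψ]

end Projection

/-- Conjugation by a grouplike `ι a` rescales each `ψ g v`. -/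
lemma ι_mul_ψ (a g : G) (v : Fin (n g) → k) :
    D.ι a * D.ψ g v = (((F a g)⁻¹ : kˣ) : k) • (D.ψ g v * D.ι a) := by
  by_cases hg : F g g = -1
  · rw [D.comm_ψι g a hg, smul_smul, Units.inv_mul, one_smul]
  · simp [D.ψ_eq_zero g hg]

lemma ι_mul_mem_s10 (a : G) {b : H}
    (hb : b ∈ Algebra.adjoin k (⋃ g : G, Set.range (D.ψ g))) :
    ∃ b' ∈ Algebra.adjoin k (⋃ g : G, Set.range (D.ψ g)), D.ι a * b = b' * D.ι a := by
  induction hb using Algebra.adjoin_induction with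
  | mem y hy =>
    obtain ⟨g, v, rfl⟩ := Set.mem_iUnion.1 hy
    exact ⟨_, Subalgebra.smul_mem _ (Algebra.subset_adjoin hy) _,
      (D.ι_mul_ψ a g v).trans (smul_mul_assoc _ _ _).symm⟩
  | algebraMap c => exact ⟨_, Subalgebra.algebraMap_mem _ c, (Algebra.commutes c _).symm⟩
  | add y z _ _ hy hz =>
    obtain ⟨y', hy', ey⟩ := hy
    obtain ⟨z', hz', ez⟩ := hz
    exact ⟨_, add_mem hy' hz', by rw [mul_add, ey, ez, add_mul]⟩
  | mul y z _ _ hy hz =>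
    obtain ⟨y', hy', ey⟩ := hy
    obtain ⟨z', hz', ez⟩ := hz
    exact ⟨_, mul_mem hy' hz', by rw [← mul_assoc, ey, mul_assoc, ez, mul_assoc]⟩

lemma adjoin_mul_span_eq_top :
    Subalgebra.toSubmodule (Algebra.adjoin k (⋃ g : G, Set.range (D.ψ g))) *
      Submodule.span k (Set.range D.ι) = ⊤ := by
  rw [eq_top_iff, ← Algebra.top_toSubmodule, ← D.generates]
  have h1 : (1 : H) ∈ Submodule.span k (Set.range D.ι) :=
    Submodule.subset_span ⟨1, map_one D.ι⟩
  refine toSubmodule_adjoin_le ?_ ?_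
  · simpa using Submodule.mul_mem_mul (one_mem (Algebra.adjoin k (⋃ g, Set.range (D.ψ g)))) h1
  rintro x hx y hy
  induction hy using Submodule.mul_induction_on' with
  | add y _ z _ hy hz => rw [mul_add]; exact add_mem hy hz
  | mem_mul_mem b hb c hc =>
    rw [← mul_assoc]
    obtain ⟨a, rfl⟩ | hx := hx
    · obtain ⟨b', hb', e⟩ := D.ι_mul_mem_s10 a hb
      rw [e, mul_assoc]
      refine Submodule.mul_mem_mul hb' ?_
      rw [← D.toSubmodule_adjoin_range_ι] at hc ⊢
      exact (Algebra.adjoin k (Set.range D.ι)).mul_mem (Algebra.subset_adjoin ⟨a, rfl⟩) hc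
    · exact Submodule.mul_mem_mul (Subalgebra.mul_mem _ (Algebra.subset_adjoin hx) hb) hc

section Basis

variable {X : Type*} (e : (Σ g : {g : G // F g g = -1}, Fin (n g)) ≃ X)

/-- The group element in whose component the generator indexed by `i` lies. -/
def degree (i : X) : {g : G // F g g = -1} := (e.symm i).1

/-- The standard basis vectors of all spaces `V_g`, as elements of `H`, indexed by `X`. -/
def generator (i : X) : H := D.ψ (e.symm i).1 (Pi.single (e.symm i).2 1)

lemma adjoin_range_generator :
    Algebra.adjoin k (Set.range (D.generator e)) =
      Algebra.adjoin k (⋃ g : G, Set.range (D.ψ g)) := by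
  apply le_antisymm
  · refine Algebra.adjoin_mono ?_
    rintro _ ⟨i, rfl⟩
    exact Set.mem_iUnion.2 ⟨_, _, rfl⟩
  · refine Algebra.adjoin_le fun y hy => ?_
    obtain ⟨g, v, rfl⟩ := Set.mem_iUnion.1 hy
    by_cases hg : F g g = -1
    · rw [← Finset.univ_sum_single v, map_sum]
      refine sum_mem fun j _ => ?_
      have hj : Pi.single j (v j) = v j • (Pi.single j 1 : Fin (n g) → k) := by
        rw [← Pi.single_smul, smul_eq_mul, mul_one]
      rw [hj, map_smul]
      refine Subalgebra.smul_mem _ (Algebra.subset_adjoin ?_) _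
      refine ⟨e ⟨⟨g, hg⟩, j⟩, ?_⟩
      rw [generator, e.symm_apply_apply]
    · simp [D.ψ_eq_zero g hg]

lemma generator_mul_generator (i j : X) :
    D.generator e i * D.generator e j =
      (F (degree e j) (degree e i) : k) • (D.generator e j * D.generator e i) :=
  D.comm_ψψ _ _ (degree e i).2 (degree e j).2 _ _

lemma generator_mul_self [CharZero k] (i : X) : D.generator e i * D.generator e i = 0 := by
  have h := D.generator_mul_generator e i i
  rw [(degree e i).2, Units.val_neg, Units.val_one, neg_smul, one_smul] at h
  rw [← add_eq_zero_iff_eq_neg, ← two_smul k] at h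
  exact (smul_eq_zero_iff_right two_ne_zero).1 h

/-- `H` acts on functions on finite sets of generators, each generator acting as a creation
operator. -/
lemma exists_fock_representation (hF : IsNondegSkewForm k G F) {N : ℕ}
    (e : (Σ g : {g : G // F g g = -1}, Fin (n g)) ≃ Fin N) :
    ∃ (r : Fin N → Fin N → k) (θ : H →ₐ[k] Module.End k (Finset (Fin N) → H)),
      (∀ i j, r i j ≠ 0) ∧ ∀ i, θ (D.generator e i) = creation H r i := by
  classical
  let r : Fin N → Fin N → k := fun i j => if j < i then F (degree e j) (degree e i) else 1
  have hr : ∀ i j, i ≠ j → r i j = F (degree e j) (degree e i) * r j i := by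
    intro i j hij
    obtain h | h := hij.lt_or_gt
    · simp only [r, h, h.not_gt, if_true, if_false, hF.mul_swap]
    · simp only [r, h, h.not_gt, if_true, if_false, mul_one]
  let χ : Fin N → G →* kˣ := fun i =>
    { toFun := fun a => (F a (degree e i))⁻¹
      map_one' := by simp [hF.one_left]
      map_mul' := fun a b => by rw [hF.mul_left, mul_inv] }
  let ζ : ∀ g : G, (Fin (n g) → k) →ₗ[k] Module.End k (Finset (Fin N) → H) := fun g =>
    if hg : F g g = -1 then
      ∑ j, (LinearMap.proj j).smulRight (creation H r (e ⟨⟨g, hg⟩, j⟩))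
    else 0
  have hζ : ∀ g (hg : F g g = -1) v,
      ζ g v = ∑ j, v j • creation H r (e ⟨⟨g, hg⟩, j⟩) := by
    intro g hg v
    simp [ζ, hg]
  obtain ⟨θ, hθ, -⟩ := D.free (Module.End k (Finset (Fin N) → H)) (diagonalOperator H χ) ζ
    (fun g hg => by simp [ζ, hg])
    (fun g h hg hh v w => by
      rw [hζ g hg, hζ h hh, Finset.sum_mul_sum, Finset.sum_mul_sum, Finset.sum_comm,
        Finset.smul_sum]
      refine Finset.sum_congr rfl fun i _ => ?_
      rw [Finset.smul_sum]
      refine Finset.sum_congr rfl fun j _ => ?_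
      have := creation_mul_creation (M := H) (hr (e ⟨⟨g, hg⟩, j⟩) (e ⟨⟨h, hh⟩, i⟩))
      rw [smul_mul_smul_comm, smul_mul_smul_comm, this, smul_smul, smul_smul]
      simp only [degree, Equiv.symm_apply_apply]
      congr 1
      ring)
    (fun g a hg v => by
      rw [hζ g hg, Finset.sum_mul, Finset.mul_sum, Finset.smul_sum]
      refine Finset.sum_congr rfl fun i _ => ?_
      have h : (χ (e ⟨⟨g, hg⟩, i⟩) a)⁻¹ = F a g := by simp [χ, degree]
      rw [smul_mul_assoc, creation_mul_diagonalOperator, h, mul_smul_comm, smul_comm])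
  refine ⟨r, θ, fun i j => ?_, fun i => ?_⟩
  · by_cases h : j < i <;> simp [r, h]
  · rw [generator, hθ.2, hζ _ (e.symm i).1.2, Finset.sum_eq_single (e.symm i).2]
    · rw [Pi.single_eq_same, one_smul]
      exact congrArg (creation H r) (e.apply_symm_apply i)
    · intro j _ hj
      simp [hj]
    · simp

end Basis

open scoped Classical in
lemma finrank_adjoin [CharZero k] [Fintype G] (hF : IsNondegSkewForm k G F) :
    Module.finrank k
        (Subalgebra.toSubmodule (Algebra.adjoin k (⋃ g : G, Set.range (D.ψ g)))) =
      ∏ g ∈ Finset.univ.filter (fun g : G => F g g = -1), 2 ^ n g := by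
  let e := Fintype.equivFin (Σ g : {g : G // F g g = -1}, Fin (n g))
  have : Nontrivial H := (Bialgebra.counitAlgHom k H).domain_nontrivial
  obtain ⟨r, θ, hr, hθ⟩ := D.exists_fock_representation hF e
  rw [← D.adjoin_range_generator e, toSubmodule_adjoin_range_eq_span_listProd
    (D.generator_mul_generator e) (D.generator_mul_self e),
    finrank_span_eq_card (linearIndependent_listProd_of_creation hr θ hθ), Fintype.card_finset,
    Fintype.card_fin, Fintype.card_sigma, Finset.prod_pow_eq_pow_sum]
  congr 1
  simp only [Fintype.card_fin]
  exact (Finset.sum_subtype _ (by simp) n).symm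

end HDPresentation

open scoped Classical in
/-- Let `D = (G,F,n)` be a datum over an algebraically closed field `k`
of characteristic `0` and `H(D)` the associated Hopf algebra. Then the map
`π : H(D) → k[G]` determined by `π(a) = a` for `a ∈ G` and `π(x) = 0` for `x ∈ 𝓑` is a
projection of Hopf algebras (here `k[G]` is realized as the span of the grouplikes
`ι(a)` inside `H(D)`), and `H(D) = B × k[G]` is a biproduct, where
`B := ⊗_{g ∈ I_F} ΛV_g` is the subalgebra generated by the `V_g`'s — it coincides with
the coinvariants `{x | (I ⊗ π)Δ(x) = x ⊗ 1}`, has dimension `∏_{g ∈ I_F} 2^{n_g}`, and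
multiplication induces a linear isomorphism `B ⊗ k[G] ≅ H(D)`. -/
theorem HD_projection_and_biproduct
    (k : Type u) [Field k] [IsAlgClosed k] [CharZero k]
    (G : Type w) [CommGroup G] [Fintype G] (F : G → G → kˣ) (n : G → ℕ)
    (hF : IsNondegSkewForm k G F)
    (H : Type v) [Ring H] [HopfAlgebra k H] (D : HDPresentation k G F n H) :
    ∃ π : H →ₐ[k] H,
      (∀ x : H, Coalgebra.comul (R := k) (π x) =
        TensorProduct.map π.toLinearMap π.toLinearMap (Coalgebra.comul (R := k) x)) ∧
      (∀ x : H, Coalgebra.counit (R := k) (π x) = Coalgebra.counit (R := k) x) ∧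
      (∀ a : G, π (D.ι a) = D.ι a) ∧
      (∀ (g : G) (v : Fin (n g) → k), π (D.ψ g v) = 0) ∧
      LinearMap.range π.toLinearMap = Submodule.span k (Set.range ⇑D.ι) ∧
      coinvariants k π.toLinearMap =
        Subalgebra.toSubmodule (Algebra.adjoin k (⋃ g : G, Set.range ⇑(D.ψ g))) ∧
      Function.Bijective
        (LinearMap.mul' k H ∘ₗ
          TensorProduct.map (coinvariants k π.toLinearMap).subtype
            (Submodule.span k (Set.range ⇑D.ι)).subtype) ∧
      Module.finrank k (coinvariants k π.toLinearMap) =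
        ∏ g ∈ Finset.univ.filter (fun g : G => F g g = -1), 2 ^ n g := by
  obtain ⟨π, hι, hψ⟩ := D.exists_projection
  have hgl : ∀ a ∈ Set.range D.ι, IsGrouplike k H a := by
    rintro _ ⟨a, rfl⟩
    exact D.ι_grouplike a
  have hfix : ∀ a ∈ Set.range D.ι, π a = a := by
    rintro _ ⟨a, rfl⟩
    exact hι a
  have hB := adjoin_le_coinvariants (π := π) (s := ⋃ g : G, Set.range (D.ψ g))
    (Set.iUnion_subset fun g => Set.range_subset_iff.2 fun v =>
      HDPresentation.ψ_mem_coinvariants hψ g v)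
  have hcoinv := coinvariants_eq_of_mul_span_eq_top hgl hfix ⟨1, map_one D.ι⟩ hB
    D.adjoin_mul_span_eq_top
  refine ⟨π, HDPresentation.comul_projection hι hψ, HDPresentation.counit_projection hι hψ,
    hι, hψ, HDPresentation.range_projection hι hψ, hcoinv,
    ⟨injective_mul_coinvariants hgl hfix,
      surjective_mul_coinvariants hB D.adjoin_mul_span_eq_top⟩, ?_⟩
  rw [hcoinv, D.finrank_adjoin hF]

end Paper
end
end
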